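/- arXiv:1401.1393 — 2 statements merged into one kernel-verified Lean document; each statement's English description precedes it below -/
import Mathlib

section
/- Let S be a proper dyadic subbase of X. If x and y are distinct points of X, then there exist n ∈ ℕ and a ∈ {0,1} such that x ∈ S_{n,a} and y ∈ S_{n,1−a}; equivalently, x̃ and ỹ are incompatible in 𝕋^ω. (Proposition 2.5(2)) -/
open Set Topology TopologicalSpace

/-- The three-element set 𝕋 = {0, 1, ⊥}. `digit b` is a digit (0 or 1), `bot` is ⊥. -/
inductive TT where
  | bot : TT
  | digit : Bool → TT
  deriving DecidableEq

/-- The topology on 𝕋 whose open sets are ∅, {0}, {1}, {0,1}, 𝕋. -/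
instance : TopologicalSpace TT :=
  generateFrom {{TT.digit false}, {TT.digit true}}

/-- The pointwise order ⊑ on 𝕋^ω (⊥ ⊑ 0, ⊥ ⊑ 1, digits incomparable). -/
def TLe (p q : ℕ → TT) : Prop := ∀ k (b : Bool), p k = TT.digit b → q k = TT.digit b

/-- Compatibility in 𝕋^ω: existence of a common upper bound. -/
def TCompat (p q : ℕ → TT) : Prop := ∃ r, TLe p r ∧ TLe q r

/-- dom(p) = the set of positions where p has a digit. -/
def Tdom (p : ℕ → TT) : Set ℕ := {k | p k ≠ TT.bot}

/-- p is a finite bottomed sequence (an element of 𝕋^*). -/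
def TFin (p : ℕ → TT) : Prop := (Tdom p).Finite

/-- The truncation p|_n. -/
def trunc (p : ℕ → TT) (n : ℕ) : ℕ → TT := fun k => if k < n then p k else TT.bot

/-- The pointwise least upper bound of two (compatible) bottomed sequences. -/
def tsup (d e : ℕ → TT) : ℕ → TT := fun k => if d k = TT.bot then e k else d k

/-- A dyadic subbase of X: a family of regular open sets, pairwise exteriors,
forming a subbase of the topology of X. -/
structure DyadicSubbase (X : Type*) [t : TopologicalSpace X] where
  S : ℕ → Bool → Set X
  regOpen : ∀ n a, S n a = interior (closure (S n a))
  compl : ∀ n, S n true = (closure (S n false))ᶜ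
  subbase : generateFrom {U | ∃ n a, U = S n a} = t

variable {X : Type*} [TopologicalSpace X]

open Classical in
/-- The embedding φ_S : X → 𝕋^ω. -/
noncomputable def phi (D : DyadicSubbase X) (x : X) : ℕ → TT := fun n =>
  if x ∈ D.S n false then TT.digit false
  else if x ∈ D.S n true then TT.digit true
  else TT.bot

/-- S(p) = ⋂_{k ∈ dom p} S_{k, p(k)}. -/
def Sint (D : DyadicSubbase X) (p : ℕ → TT) : Set X :=
  {x | ∀ k (b : Bool), p k = TT.digit b → x ∈ D.S k b}

/-- S̄(p) = ⋂_{k ∈ dom p} cl(S_{k, p(k)}). -/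
def SbarInt (D : DyadicSubbase X) (p : ℕ → TT) : Set X :=
  {x | ∀ k (b : Bool), p k = TT.digit b → x ∈ closure (D.S k b)}

/-- S is a proper dyadic subbase: cl(S(e)) = S̄(e) for all finite bottomed e. -/
def IsProperDS (D : DyadicSubbase X) : Prop :=
  ∀ e, TFin e → closure (Sint D e) = SbarInt D e

/-- ↑X̃ = {p : x̃ ⊑ p for some x}. -/
def upX (D : DyadicSubbase X) : Set (ℕ → TT) := {p | ∃ x, TLe (phi D x) p}

/-- 2^ω, the bottom-free sequences. -/
def twoOmega : Set (ℕ → TT) := {p | ∀ k, p k ≠ TT.bot}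

/-- K_S = {x̃|_m : x ∈ X, m ∈ ℕ}. -/
def KS (D : DyadicSubbase X) : Set (ℕ → TT) := {e | ∃ x m, e = trunc (phi D x) m}

/-- K̂_S = {p|_m : p ∈ ↑X̃, m ∈ ℕ}. -/
def KhatS (D : DyadicSubbase X) : Set (ℕ → TT) := {e | ∃ p ∈ upX D, ∃ m, e = trunc p m}

/-- I is an ideal of the subposet K of 𝕋^ω. -/
def IsIdealOf (K I : Set (ℕ → TT)) : Prop :=
  I ⊆ K ∧ I.Nonempty ∧ (∀ d ∈ I, ∀ e ∈ I, ∃ f ∈ I, TLe d f ∧ TLe e f) ∧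
    (∀ d ∈ K, ∀ e ∈ I, TLe d e → d ∈ I)

/-- p is the pointwise least upper bound of the set I in 𝕋^ω. -/
def IsSupOf (I : Set (ℕ → TT)) (p : ℕ → TT) : Prop :=
  ∀ k (b : Bool), p k = TT.digit b ↔ ∃ e ∈ I, e k = TT.digit b

/-- D_S ⊆ 𝕋^ω: least upper bounds of ideals of K_S. -/
def DS (D : DyadicSubbase X) : Set (ℕ → TT) := {p | ∃ I, IsIdealOf (KS D) I ∧ IsSupOf I p}

/-- D̂_S ⊆ 𝕋^ω: least upper bounds of ideals of K̂_S. -/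
def DhatS (D : DyadicSubbase X) : Set (ℕ → TT) := {p | ∃ I, IsIdealOf (KhatS D) I ∧ IsSupOf I p}

/-- The limit (non-compact) elements of a subdomain E of 𝕋^ω:
those with infinite domain. -/
def limitsOf (E : Set (ℕ → TT)) : Set (ℕ → TT) := {p ∈ E | (Tdom p).Infinite}

/-- The minimal elements of a subset A of 𝕋^ω. -/
def minOf (A : Set (ℕ → TT)) : Set (ℕ → TT) := {p ∈ A | ∀ q ∈ A, TLe q p → q = p}

/-- q is an immediate successor of p in the subposet K of 𝕋^ω. -/
def ImmSucc (K : Set (ℕ → TT)) (p q : ℕ → TT) : Prop :=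
  p ∈ K ∧ q ∈ K ∧ TLe p q ∧ p ≠ q ∧ ¬∃ r ∈ K, TLe p r ∧ p ≠ r ∧ TLe r q ∧ r ≠ q

/-- A Hausdorff space is adhesive if it has at least two points and the closures
of any two nonempty open sets intersect. -/
def Adhesive (Y : Type*) [TopologicalSpace Y] : Prop :=
  (∃ y z : Y, y ≠ z) ∧
    ∀ U V : Set Y, IsOpen U → IsOpen V → U.Nonempty → V.Nonempty →
      (closure U ∩ closure V).Nonempty

/-- A space is strongly nonadhesive if every open subspace is nonadhesive. -/
def StronglyNonadhesive (Y : Type*) [TopologicalSpace Y] : Prop :=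
  ∀ U : Set Y, IsOpen U → ¬ Adhesive U
theorem aux_compl {X : Type*} [TopologicalSpace X] (D : DyadicSubbase X) (n : ℕ) (a : Bool) :
    D.S n (!a) = (closure (D.S n a))ᶜ := by
  cases a
  · exact D.compl n
  · have h := D.regOpen n false
    rw [Bool.not_true, D.compl n, closure_compl, compl_compl]
    exact h

theorem aux_phi {X : Type*} [TopologicalSpace X] (D : DyadicSubbase X) (x : X) (n : ℕ) (a : Bool) :
    phi D x n = TT.digit a ↔ x ∈ D.S n a := by
  have h : x ∈ D.S n true → x ∉ D.S n false := by
    intro h1 h2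
    rw [D.compl n] at h1
    exact h1 (subset_closure h2)
  unfold phi
  cases a <;> by_cases h0 : x ∈ D.S n false <;> by_cases h1 : x ∈ D.S n true <;> simp_all

theorem aux_mono {X : Type*} [TopologicalSpace X] (D : DyadicSubbase X) (p : ℕ → TT) {m n : ℕ}
    (h : m ≤ n) : Sint D (trunc p n) ⊆ Sint D (trunc p m) := by
  intro z hz k b hk
  apply hz k b
  unfold trunc at hk ⊢
  by_cases hkm : k < m
  · rw [if_pos hkm] at hk
    rw [if_pos (by omega), hk]
  · rw [if_neg hkm] at hk
    cases hk

theorem aux_nhds {X : Type*} [TopologicalSpace X] (D : DyadicSubbase X) (x : X) (U : Set X)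
    (hU : GenerateOpen {U | ∃ n a, U = D.S n a} U) :
    x ∈ U → ∃ n, Sint D (trunc (phi D x) n) ⊆ U := by
  induction hU with
  | basic s hs =>
    obtain ⟨n, a, rfl⟩ := hs
    intro hx
    refine ⟨n + 1, fun z hz => hz n a ?_⟩
    simp [trunc, (aux_phi D x n a).2 hx]
  | univ => exact fun _ => ⟨0, subset_univ _⟩
  | inter s t _ _ ihs iht =>
    intro hx
    obtain ⟨m, hm⟩ := ihs hx.1
    obtain ⟨n, hn⟩ := iht hx.2
    exact ⟨max m n, subset_inter ((aux_mono D _ (le_max_left m n)).trans hm)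
      ((aux_mono D _ (le_max_right m n)).trans hn)⟩
  | sUnion C _ ih =>
    rintro ⟨s, hs, hx⟩
    obtain ⟨n, hn⟩ := ih s hs hx
    exact ⟨n, hn.trans (subset_sUnion_of_mem hs)⟩

/-- Proposition 2.5(2): distinct points are separated by some subbase element;
equivalently x̃ and ỹ are incompatible. -/
theorem stmt_3 {X : Type*} [TopologicalSpace X] [T2Space X] [SecondCountableTopology X]
    (D : DyadicSubbase X) (hD : IsProperDS D) {x y : X} (hxy : x ≠ y) :
    (∃ n : ℕ, ∃ a : Bool, x ∈ D.S n a ∧ y ∈ D.S n (!a)) ∧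
    ¬ TCompat (phi D x) (phi D y) := by
  have key : ∃ n : ℕ, ∃ a : Bool, x ∈ D.S n a ∧ y ∈ D.S n (!a) := by
    by_contra hcon
    push Not at hcon
    obtain ⟨U, V, hU, hV, hxU, hyV, hUV⟩ := t2_separation hxy
    have hU' : GenerateOpen {U | ∃ n a, U = D.S n a} U := by
      have h2 := hU
      rw [← D.subbase] at h2
      exact h2
    obtain ⟨n, hn⟩ := aux_nhds D x U hU' hxU
    have hfin : TFin (trunc (phi D x) n) := by
      refine (finite_lt_nat n).subset fun k hk => ?_
      by_contra hlt
      exact hk (if_neg hlt)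
    have hy : y ∈ SbarInt D (trunc (phi D x) n) := by
      intro k b hk
      unfold trunc at hk
      split_ifs at hk
      have h3 := hcon k b ((aux_phi D x k b).1 hk)
      rw [aux_compl] at h3
      exact not_not.1 h3
    rw [← hD _ hfin] at hy
    obtain ⟨z, hzV, hz⟩ := mem_closure_iff.1 hy V hV hyV
    exact disjoint_left.1 hUV (hn hz) hzV
  refine ⟨key, ?_⟩
  rintro ⟨r, h1, h2⟩
  obtain ⟨n, a, hx, hy⟩ := key
  have e1 := h1 n a ((aux_phi D x n a).2 hx)
  have e2 := h2 n (!a) ((aux_phi D y n (!a)).2 hy)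
  rw [e1] at e2
  cases a <;> simp at e2
end

section
/- Suppose X is a strongly nonadhesive space and S is a proper dyadic subbase of X. Then (i) the poset L(D_S) has enough minimal elements and min(L(D_S)) is a compact topological space (with the subspace topology of 𝕋^ω), and (ii) the poset L(D̂_S) has enough minimal elements and min(L(D̂_S)) is compact. (Theorem 5.12) -/
open Set Topology TopologicalSpace

variable {X : Type*} [TopologicalSpace X]

theorem tt_cases (t : TT) : t = TT.bot ∨ ∃ b, t = TT.digit b := by
  cases t with
  | bot => exact Or.inl rfl
  | digit b => exact Or.inr ⟨b, rfl⟩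

theorem TLe_refl (p : ℕ → TT) : TLe p p := fun _ _ h => h

theorem TLe_trans {p q r : ℕ → TT} (h : TLe p q) (h' : TLe q r) : TLe p r :=
  fun k b e => h' k b (h k b e)

theorem TLe_bot {p q : ℕ → TT} (h : TLe p q) {k : ℕ} (hk : q k = TT.bot) : p k = TT.bot := by
  rcases tt_cases (p k) with e | ⟨b, e⟩
  · exact e
  · have := h k b e
    rw [hk] at this
    cases this

theorem TLe_antisymm {p q : ℕ → TT} (h : TLe p q) (h' : TLe q p) : p = q := by
  funext k
  rcases tt_cases (p k) with e | ⟨b, e⟩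
  · rw [e, TLe_bot h' e]
  · rw [e, h k b e]

theorem trunc_lt {p : ℕ → TT} {n k : ℕ} (h : k < n) : trunc p n k = p k := by
  simp [trunc, h]

theorem trunc_ge {p : ℕ → TT} {n k : ℕ} (h : n ≤ k) : trunc p n k = TT.bot := by
  simp [trunc, not_lt.2 h]

theorem trunc_trunc (p : ℕ → TT) (m n : ℕ) : trunc (trunc p m) n = trunc p (min m n) := by
  funext k
  simp only [trunc, lt_min_iff]
  by_cases h1 : k < m <;> by_cases h2 : k < n <;> simp [h1, h2]

theorem trunc_TLe (p : ℕ → TT) (n : ℕ) : TLe (trunc p n) p := by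
  intro k b h
  by_cases hk : k < n
  · rwa [trunc_lt hk] at h
  · rw [trunc_ge (not_lt.1 hk)] at h; cases h

theorem trunc_congr {p q : ℕ → TT} {n : ℕ} (h : ∀ k < n, p k = q k) : trunc p n = trunc q n := by
  funext k
  by_cases hk : k < n
  · rw [trunc_lt hk, trunc_lt hk, h k hk]
  · rw [trunc_ge (not_lt.1 hk), trunc_ge (not_lt.1 hk)]

theorem trunc_fin (p : ℕ → TT) (n : ℕ) : TFin (trunc p n) := by
  apply (Set.finite_lt_nat n).subset
  intro k hk
  by_contra h
  exact hk (trunc_ge (not_lt.1 h))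

/-- Characterization of the ideal completion via truncations. -/
theorem mem_compl_iff_trunc {K : Set (ℕ → TT)} (hK : ∀ e ∈ K, ∀ n, trunc e n ∈ K) (p : ℕ → TT) :
    (∃ I, IsIdealOf K I ∧ IsSupOf I p) ↔ ∀ n, trunc p n ∈ K := by
  constructor
  · rintro ⟨I, ⟨hIK, ⟨e0, he0⟩, hdir, -⟩, hsup⟩ n
    have key : ∀ n, ∃ e ∈ I, TLe (trunc p n) e := by
      intro n
      induction n with
      | zero =>
        refine ⟨e0, he0, ?_⟩
        intro k b h
        rw [trunc_ge (Nat.zero_le k)] at h; cases h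
      | succ n ih =>
        obtain ⟨e, he, hle⟩ := ih
        rcases tt_cases (p n) with h | ⟨b, h⟩
        · refine ⟨e, he, ?_⟩
          intro k b hk
          rcases lt_trichotomy k n with h1 | h1 | h1
          · rw [trunc_lt (by omega)] at hk
            exact hle k b (by rw [trunc_lt h1, hk])
          · subst h1
            rw [trunc_lt (by omega), h] at hk; cases hk
          · rw [trunc_ge (by omega)] at hk; cases hk
        · obtain ⟨e', he', hb⟩ := (hsup n b).1 h
          obtain ⟨f, hf, h1, h2⟩ := hdir e he e' he'
          refine ⟨f, hf, ?_⟩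
          intro k c hk
          rcases lt_trichotomy k n with h3 | h3 | h3
          · rw [trunc_lt (by omega)] at hk
            exact h1 k c (hle k c (by rw [trunc_lt h3, hk]))
          · subst h3
            rw [trunc_lt (by omega), h] at hk
            rw [← hk]
            exact h2 k b hb
          · rw [trunc_ge (by omega)] at hk; cases hk
    obtain ⟨e, he, hle⟩ := key n
    have hep : TLe e p := fun k b h => (hsup k b).2 ⟨e, he, h⟩
    have : trunc e n = trunc p n := by
      apply trunc_congr
      intro k hk
      rcases tt_cases (p k) with h | ⟨b, h⟩
      · rw [h, TLe_bot hep h]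
      · rw [h, hle k b (by rw [trunc_lt hk, h])]
    rw [← this]
    exact hK e (hIK he) n
  · intro h
    refine ⟨{e | e ∈ K ∧ ∃ n, TLe e (trunc p n)}, ⟨fun e he => he.1, ⟨trunc p 0, h 0, 0, TLe_refl _⟩,
      ?_, ?_⟩, ?_⟩
    · rintro d ⟨-, n, hn⟩ e ⟨-, m, hm⟩
      have mono : ∀ {a b : ℕ}, a ≤ b → TLe (trunc p a) (trunc p b) := by
        intro a b hab
        have : trunc p a = trunc (trunc p b) a := by rw [trunc_trunc, min_eq_right hab]
        rw [this]; exact trunc_TLe _ _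
      exact ⟨trunc p (max n m), ⟨h _, _, TLe_refl _⟩, TLe_trans hn (mono (le_max_left _ _)),
        TLe_trans hm (mono (le_max_right _ _))⟩
    · rintro d hd e ⟨-, n, hn⟩ hde
      exact ⟨hd, n, TLe_trans hde hn⟩
    · intro k b
      constructor
      · intro hk
        exact ⟨trunc p (k+1), ⟨h _, _, TLe_refl _⟩, by rw [trunc_lt (by omega), hk]⟩
      · rintro ⟨e, ⟨-, n, hn⟩, he⟩
        exact trunc_TLe p n k b (hn k b he)

/-- Closedness in the Cantor (patch) topology. -/
def PatchClosed (L : Set (ℕ → TT)) : Prop :=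
  ∀ p, (∀ n, ∃ q ∈ L, ∀ k < n, q k = p k) → p ∈ L

theorem compact_of_patchClosed {L : Set (ℕ → TT)} (hL : PatchClosed L) : IsCompact L := by
  let g : Bool × Bool → TT := fun a => if a.1 then TT.digit a.2 else TT.bot
  have gs : ∀ t, ∃ a, g a = t := by
    intro t
    cases t with
    | bot => exact ⟨(false, false), rfl⟩
    | digit b => exact ⟨(true, b), rfl⟩
  let G : (ℕ → Bool × Bool) → (ℕ → TT) := fun u k => g (u k)
  have hG : Continuous G := by
    apply continuous_pi
    intro k
    have : Continuous g := continuous_of_discreteTopology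
    exact this.comp (continuous_apply k)
  have hc : IsClosed (G ⁻¹' L) := by
    rw [← closure_subset_iff_isClosed]
    intro u hu
    apply hL
    intro n
    have ho : IsOpen {w : ℕ → Bool × Bool | ∀ k < n, w k = u k} := by
      have : {w : ℕ → Bool × Bool | ∀ k < n, w k = u k} =
          ⋂ k ∈ Set.Iio n, (fun w : ℕ → Bool × Bool => w k) ⁻¹' {u k} := by
        ext w; simp
      rw [this]
      exact (Set.finite_Iio n).isOpen_biInter
        (fun k _ => (isOpen_discrete _).preimage (continuous_apply k))
    obtain ⟨w, hw, hwL⟩ := mem_closure_iff.1 hu _ ho (fun k _ => rfl)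
    exact ⟨G w, hwL, fun k hk => by simp only [G, hw k hk]⟩
  have : G '' (G ⁻¹' L) = L := by
    apply Set.image_preimage_eq
    intro p
    choose u hu using fun k => gs (p k)
    exact ⟨u, funext hu⟩
  rw [← this]
  exact hc.isCompact.image hG

open Classical in
theorem enough_min {L : Set (ℕ → TT)} (hL : PatchClosed L) :
    ∀ p ∈ L, ∃ q ∈ minOf L, TLe q p := by
  intro p hp
  let T := {q : ℕ → TT // q ∈ L ∧ TLe q p}
  have := exists_maximal_of_chains_bounded (α := T) (r := fun a b => TLe b.1 a.1) ?_
    (fun {a b c} h1 h2 => TLe_trans h2 h1)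
  · obtain ⟨m, hm⟩ := this
    refine ⟨m.1, ⟨m.2.1, ?_⟩, m.2.2⟩
    intro q hq hqm
    exact TLe_antisymm hqm (hm ⟨q, hq, TLe_trans hqm m.2.2⟩ hqm)
  · intro c hc
    rcases c.eq_empty_or_nonempty with rfl | ⟨a0, ha0⟩
    · exact ⟨⟨p, hp, TLe_refl p⟩, fun a ha => ha.elim⟩
    let r : ℕ → TT := fun k => if h : ∃ b, ∀ a ∈ c, a.1 k = TT.digit b
      then TT.digit h.choose else TT.bot
    have r1 : ∀ a ∈ c, TLe r a.1 := by
      intro a ha k b hk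
      by_cases h : ∃ b, ∀ a ∈ c, a.1 k = TT.digit b
      · simp only [r, dif_pos h] at hk
        rw [← hk]; exact h.choose_spec a ha
      · simp only [r, dif_neg h] at hk
        cases hk
    have r2 : ∀ k, r k = TT.bot → ∃ a ∈ c, a.1 k = TT.bot := by
      intro k hk
      by_cases h : ∃ b, ∀ a ∈ c, a.1 k = TT.digit b
      · simp only [r, dif_pos h] at hk
        cases hk
      · push Not at h
        rcases tt_cases (a0.1 k) with e | ⟨b, e⟩
        · exact ⟨a0, ha0, e⟩
        · obtain ⟨a, ha, hab⟩ := h b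
          refine ⟨a, ha, ?_⟩
          rcases tt_cases (a.1 k) with e' | ⟨b', e'⟩
          · exact e'
          · exfalso
            have hne : a ≠ a0 := by
              rintro rfl; exact hab e
            rcases hc ha ha0 hne with h1 | h1
            · exact hab (h1 k b e)
            · have := h1 k b' e'
              rw [e] at this
              rw [← this] at e'
              exact hab e'
    have r3 : ∀ n, ∃ a ∈ c, ∀ k < n, a.1 k = r k := by
      intro n
      induction n with
      | zero => exact ⟨a0, ha0, fun k hk => by omega⟩
      | succ n ih =>
        obtain ⟨a, ha, h⟩ := ih
        rcases tt_cases (r n) with e | ⟨b, e⟩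
        · obtain ⟨a', ha', h'⟩ := r2 n e
          have hcases : TLe a.1 a'.1 ∨ TLe a'.1 a.1 := by
            by_cases hne : a = a'
            · subst hne; exact Or.inl (TLe_refl _)
            · exact (hc ha ha' hne).symm
          rcases hcases with h1 | h1
          · refine ⟨a, ha, fun k hk => ?_⟩
            rcases Nat.lt_succ_iff_lt_or_eq.1 hk with h2 | rfl
            · exact h k h2
            · rw [e]; exact TLe_bot h1 h'
          · refine ⟨a', ha', fun k hk => ?_⟩
            rcases Nat.lt_succ_iff_lt_or_eq.1 hk with h2 | rfl
            · rcases tt_cases (r k) with e2 | ⟨b, e2⟩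
              · rw [e2]; exact TLe_bot h1 (by rw [h k h2, e2])
              · rw [e2]; exact r1 a' ha' k b e2
            · rw [e, h']
        · refine ⟨a, ha, fun k hk => ?_⟩
          rcases Nat.lt_succ_iff_lt_or_eq.1 hk with h2 | rfl
          · exact h k h2
          · rw [e]; exact r1 a ha k b e
    have hr : r ∈ L := hL r fun n => by
      obtain ⟨a, _, h⟩ := r3 n
      exact ⟨a.1, a.2.1, h⟩
    exact ⟨⟨r, hr, TLe_trans (r1 a0 ha0) a0.2.2⟩, fun a ha => r1 a ha⟩

theorem isOpen_TT_upper {p q : ℕ → TT} (h : TLe p q) {O : Set (ℕ → TT)} (hO : IsOpen O)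
    (hp : p ∈ O) : q ∈ O := by
  have hk : ∀ k, q k ⤳ p k := by
    intro k
    rcases tt_cases (p k) with e | ⟨b, e⟩
    · rw [e, specializes_iff_forall_open]
      intro s hs hb
      have hs' : GenerateOpen {{TT.digit false}, {TT.digit true}} s := hs
      have : ∀ s : Set TT, GenerateOpen {{TT.digit false}, {TT.digit true}} s →
          TT.bot ∈ s → s = univ := by
        intro s hs
        induction hs with
        | basic s hs =>
          intro hb
          rcases hs with rfl | hs
          · cases hb
          · rw [Set.mem_singleton_iff] at hs
            subst hs
            cases hb
        | univ => intro _; rfl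
        | inter s t _ _ h1 h2 =>
          rintro ⟨h3, h4⟩
          rw [h1 h3, h2 h4, Set.univ_inter]
        | sUnion S _ ih =>
          rintro ⟨t, ht, hbt⟩
          have := ih t ht hbt
          exact Set.eq_univ_of_univ_subset (this ▸ Set.subset_sUnion_of_mem ht)
      rw [this s hs' hb]
      trivial
    · rw [e, h k b e]
  exact (specializes_pi.2 hk).mem_open hO hp

theorem min_compact {L : Set (ℕ → TT)} (hL : PatchClosed L) : IsCompact (minOf L) := by
  rw [isCompact_iff_finite_subcover]
  intro ι U hU hcov
  obtain ⟨t, ht⟩ := (compact_of_patchClosed hL).elim_finite_subcover U hU (by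
    intro p hp
    obtain ⟨q, hq, hqp⟩ := enough_min hL p hp
    obtain ⟨i, hi⟩ := Set.mem_iUnion.1 (hcov hq)
    exact Set.mem_iUnion.2 ⟨i, isOpen_TT_upper hqp (hU i) hi⟩)
  exact ⟨t, fun p hp => ht hp.1⟩

section
variable (D : DyadicSubbase X)

theorem S_open (n : ℕ) (a : Bool) : IsOpen (D.S n a) := by
  rw [D.regOpen]; exact isOpen_interior

theorem S_compl (n : ℕ) (a : Bool) : D.S n (!a) = (closure (D.S n a))ᶜ := by
  cases a
  · exact D.compl n
  · rw [← interior_compl]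
    have : D.S n false = interior (closure (D.S n false)) := D.regOpen n false
    rw [Bool.not_true, this]
    congr 1
    rw [D.compl n, compl_compl]

theorem S_disj {n : ℕ} {a b : Bool} {x : X} (ha : x ∈ D.S n a) (hb : x ∈ D.S n b) : a = b := by
  by_contra h
  have : b = !a := by cases a <;> cases b <;> simp_all
  rw [this, S_compl] at hb
  exact hb (subset_closure ha)

theorem phi_digit {x : X} {n : ℕ} {b : Bool} : phi D x n = TT.digit b ↔ x ∈ D.S n b := by
  unfold phi
  split_ifs with h1 h2
  · constructor
    · intro h; cases h; exact h1
    · intro h; rw [S_disj D h1 h]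
  · constructor
    · intro h; cases h; exact h2
    · intro h; rw [S_disj D h2 h]
  · constructor
    · intro h; cases h
    · intro h; cases b
      · exact (h1 h).elim
      · exact (h2 h).elim

theorem phi_bot_closure {x : X} {n : ℕ} (h : phi D x n = TT.bot) (b : Bool) :
    x ∈ closure (D.S n b) := by
  by_contra hn
  have : x ∈ D.S n (!b) := by rw [S_compl]; exact hn
  rw [← phi_digit D, h] at this
  cases this

theorem nhd_basis {v : X} {O : Set X} (hO : IsOpen O) (hv : v ∈ O) :
    ∃ n, Sint D (trunc (phi D v) n) ⊆ O := by
  have hmono : ∀ {n m : ℕ}, n ≤ m →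
      Sint D (trunc (phi D v) m) ⊆ Sint D (trunc (phi D v) n) := by
    intro n m hnm x hx k b hk
    apply hx k b
    by_cases h : k < n
    · rw [trunc_lt h] at hk
      rw [trunc_lt (by omega), hk]
    · rw [trunc_ge (not_lt.1 h)] at hk; cases hk
  have hg : GenerateOpen {U | ∃ n a, U = D.S n a} O := by
    have h2 := D.subbase
    have h3 : IsOpen[generateFrom {U | ∃ n a, U = D.S n a}] O := by rw [h2]; exact hO
    exact h3
  clear hO
  induction hg with
  | basic s hs =>
    obtain ⟨n, a, rfl⟩ := hs
    refine ⟨n + 1, fun x hx => hx n a ?_⟩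
    rw [trunc_lt (by omega), phi_digit]; exact hv
  | univ => exact ⟨0, fun _ _ => trivial⟩
  | inter s t _ _ h1 h2 =>
    obtain ⟨n, hn⟩ := h1 hv.1
    obtain ⟨m, hm⟩ := h2 hv.2
    exact ⟨max n m, fun x hx => ⟨hn (hmono (le_max_left _ _) hx), hm (hmono (le_max_right _ _) hx)⟩⟩
  | sUnion S _ ih =>
    obtain ⟨t, ht, hvt⟩ := hv
    obtain ⟨n, hn⟩ := ih t ht hvt
    exact ⟨n, hn.trans (Set.subset_sUnion_of_mem ht)⟩

theorem Sint_open {d : ℕ → TT} (hd : TFin d) : IsOpen (Sint D d) := by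
  have : Sint D d = ⋂ k ∈ Tdom d, {x | ∀ b, d k = TT.digit b → x ∈ D.S k b} := by
    ext x
    simp only [Sint, Set.mem_iInter, Set.mem_setOf_eq]
    constructor
    · intro h k _ b hb; exact h k b hb
    · intro h k b hb; exact h k (by simp [Tdom, hb]) b hb
  rw [this]
  apply Set.Finite.isOpen_biInter hd
  intro k _
  rcases tt_cases (d k) with e | ⟨b, e⟩
  · simp [e]
  · have : {x | ∀ b, d k = TT.digit b → x ∈ D.S k b} = D.S k b := by
      ext x; simp [e]
    rw [this]; exact S_open D k b

theorem lemmaA (hD : IsProperDS D) (hX : StronglyNonadhesive X) {d : ℕ → TT} (hd : TFin d) :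
    ∃ m, ∀ x ∈ Sint D d, ∃ j < m, d j = TT.bot ∧ phi D x j ≠ TT.bot := by
  have hU := Sint_open D hd
  have hna := hX _ hU
  by_cases h2 : ∃ y z : Sint D d, y ≠ z
  · have : ∃ V W : Set (Sint D d), IsOpen V ∧ IsOpen W ∧ V.Nonempty ∧ W.Nonempty ∧
        ¬ (closure V ∩ closure W).Nonempty := by
      by_contra hcon
      push Not at hcon
      exact hna ⟨h2, fun V W a b c e => hcon V W a b c e⟩
    obtain ⟨V, W, hV, hW, ⟨v, hv⟩, ⟨w, hw⟩, hdis⟩ := this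
    obtain ⟨n1, hn1⟩ := nhd_basis D (hU.isOpenMap_subtype_val V hV) ⟨v, hv, rfl⟩
    obtain ⟨n2, hn2⟩ := nhd_basis D (hU.isOpenMap_subtype_val W hW) ⟨w, hw, rfl⟩
    refine ⟨max n1 n2, ?_⟩
    intro x hx
    by_contra hcon
    push Not at hcon
    have key : ∀ (v : Sint D d) (V : Set (Sint D d)) (n : ℕ), n ≤ max n1 n2 →
        Sint D (trunc (phi D v.1) n) ⊆ Subtype.val '' V → (⟨x, hx⟩ : Sint D d) ∈ closure V := by
      intro v V n hn hsub
      rw [closure_subtype]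
      apply closure_mono hsub
      rw [hD _ (trunc_fin _ _)]
      intro k b hk
      have hkn : k < n := by
        by_contra h
        rw [trunc_ge (not_lt.1 h)] at hk; cases hk
      rw [trunc_lt hkn, phi_digit] at hk
      rcases tt_cases (d k) with e | ⟨c, e⟩
      · exact phi_bot_closure D (hcon k (by omega) e) b
      · have : c = b := S_disj D (v.2 k c e) hk
        subst this
        exact subset_closure (hx k c e)
    exact hdis ⟨⟨x, hx⟩, key v V n1 (le_max_left _ _) hn1, key w W n2 (le_max_right _ _) hn2⟩
  · push Not at h2
    obtain ⟨j, hj⟩ := hd.exists_notMem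
    have hj' : d j = TT.bot := by
      by_contra h; exact hj h
    refine ⟨j + 1, fun x hx => ⟨j, by omega, hj', ?_⟩⟩
    intro hb
    obtain ⟨y, hyU, hy⟩ := mem_closure_iff.1 (phi_bot_closure D hb false) _ hU hx
    have : y = x := congrArg Subtype.val (h2 ⟨y, hyU⟩ ⟨x, hx⟩)
    subst this
    rw [← phi_digit D, hb] at hy
    cases hy

theorem finite_below {e : ℕ → TT} (he : TFin e) : {d | TLe d e}.Finite := by
  have hfin : {s : Set ℕ | s ⊆ Tdom e}.Finite := he.finite_subsets
  have hdom : ∀ d ∈ {d | TLe d e}, Tdom d ∈ {s : Set ℕ | s ⊆ Tdom e} := by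
    intro d hd k hk h
    exact hk (TLe_bot hd h)
  refine Set.Finite.of_finite_image (f := Tdom) (hfin.subset ?_) ?_
  · rintro _ ⟨d, hd, rfl⟩; exact hdom d hd
  · intro d hd d' hd' heq
    funext k
    rcases tt_cases (d k) with h | ⟨b, h⟩ <;> rcases tt_cases (d' k) with h' | ⟨b', h'⟩
    · rw [h, h']
    · have : k ∈ Tdom d' := by simp [Tdom, h']
      rw [← heq] at this
      exact (this h).elim
    · have : k ∈ Tdom d := by simp [Tdom, h]
      rw [heq] at this
      exact (this h').elim
    · rw [h, h', ← hd k b h, ← hd' k b' h']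

theorem corB (hD : IsProperDS D) (hX : StronglyNonadhesive X) {e : ℕ → TT} (he : TFin e) :
    ∃ M, ∀ n ≥ M, ∀ p ∈ upX D, trunc p n ≠ e := by
  have hA : ∀ d : ℕ → TT, ∃ m, TFin d →
      ∀ x ∈ Sint D d, ∃ j < m, d j = TT.bot ∧ phi D x j ≠ TT.bot := by
    intro d
    by_cases hd : TFin d
    · obtain ⟨m, hm⟩ := lemmaA D hD hX hd
      exact ⟨m, fun _ => hm⟩
    · exact ⟨0, fun h => (hd h).elim⟩
  choose m hm using hA
  obtain ⟨M, hM⟩ := ((finite_below he).image m).bddAbove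
  refine ⟨M, ?_⟩
  rintro n hn p ⟨x, hxp⟩ rfl
  have hle : TLe (trunc (phi D x) n) (trunc p n) := by
    intro k b hk
    by_cases h : k < n
    · rw [trunc_lt h] at hk ⊢
      exact hxp k b hk
    · rw [trunc_ge (not_lt.1 h)] at hk; cases hk
  have hmM := hM ⟨_, hle, rfl⟩
  obtain ⟨j, hj, hb, hnb⟩ := hm _ (trunc_fin (phi D x) n) x (by
    intro k b hk
    rw [← phi_digit D]
    exact trunc_TLe _ _ k b hk)
  rw [trunc_lt (by omega)] at hb
  exact hnb hb

theorem patchClosed_limits (hD : IsProperDS D) (hX : StronglyNonadhesive X) {K : Set (ℕ → TT)}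
    (hK : ∀ e ∈ K, ∀ n, trunc e n ∈ K) (hKhat : K ⊆ KhatS D) :
    PatchClosed (limitsOf {p | ∃ I, IsIdealOf K I ∧ IsSupOf I p}) := by
  intro p hp
  refine ⟨?_, ?_⟩
  · apply (mem_compl_iff_trunc hK p).2
    intro n
    obtain ⟨q, hq, hqp⟩ := hp n
    rw [← trunc_congr hqp]
    exact (mem_compl_iff_trunc hK q).1 hq.1 n
  · intro hfin
    obtain ⟨M, hM⟩ := corB D hD hX (e := p) hfin
    obtain ⟨N, hN⟩ := hfin.bddAbove
    have hfar : ∀ k, N < k → p k = TT.bot := by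
      intro k hk
      by_contra h
      exact absurd (hN h) (by omega)
    obtain ⟨q, hq, hqp⟩ := hp (max M (N + 1))
    obtain ⟨k, hk, hkM⟩ := hq.2.exists_gt (max M (N + 1))
    obtain ⟨r, hr, j, hj⟩ := hKhat ((mem_compl_iff_trunc hK q).1 hq.1 (k + 1))
    have hkj : k < j := by
      by_contra h
      have h1 := congrFun hj k
      rw [trunc_lt (by omega), trunc_ge (not_lt.1 h)] at h1
      exact hk h1
    have hrp : ∀ i < max M (N + 1), r i = p i := by
      intro i hi
      have h1 := congrFun hj i
      rw [trunc_lt (by omega), trunc_lt (by omega)] at h1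
      rw [← h1, hqp i hi]
    refine hM _ (le_max_left M (N + 1)) r hr ?_
    rw [trunc_congr hrp]
    funext i
    by_cases hi : i < max M (N + 1)
    · exact trunc_lt hi
    · rw [trunc_ge (not_lt.1 hi), hfar i (by omega)]

theorem KS_trunc : ∀ e ∈ KS D, ∀ n, trunc e n ∈ KS D := by
  rintro _ ⟨x, m, rfl⟩ n
  exact ⟨x, min m n, trunc_trunc _ _ _⟩

theorem KhatS_trunc : ∀ e ∈ KhatS D, ∀ n, trunc e n ∈ KhatS D := by
  rintro _ ⟨p, hp, m, rfl⟩ n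
  exact ⟨p, hp, min m n, trunc_trunc _ _ _⟩

theorem KS_sub : KS D ⊆ KhatS D := by
  rintro _ ⟨x, m, rfl⟩
  exact ⟨phi D x, ⟨x, TLe_refl _⟩, m, rfl⟩

end

/-- Theorem 5.12: if X is strongly nonadhesive and S is proper, then L(D_S) and
L(D̂_S) have enough minimal elements and their sets of minimal elements are compact. -/
theorem stmt_16 {X : Type*} [TopologicalSpace X] [T2Space X] [SecondCountableTopology X]
    (D : DyadicSubbase X) (hD : IsProperDS D) (hX : StronglyNonadhesive X) :
    ((∀ p ∈ limitsOf (DS D), ∃ q ∈ minOf (limitsOf (DS D)), TLe q p) ∧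
      IsCompact (minOf (limitsOf (DS D)))) ∧
    ((∀ p ∈ limitsOf (DhatS D), ∃ q ∈ minOf (limitsOf (DhatS D)), TLe q p) ∧
      IsCompact (minOf (limitsOf (DhatS D)))) := by
  have h1 : PatchClosed (limitsOf (DS D)) := patchClosed_limits D hD hX (KS_trunc D) (KS_sub D)
  have h2 : PatchClosed (limitsOf (DhatS D)) :=
    patchClosed_limits D hD hX (KhatS_trunc D) (fun _ h => h)
  exact ⟨⟨enough_min h1, min_compact h1⟩, ⟨enough_min h2, min_compact h2⟩⟩
end
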